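/- Let M = (x y; z w) ∈ SL₂(ℤ) with z ≠ 0, and define n_M := (x+w)/z − sign(z)·(3 + 12·s(w,|z|)), where s is the Dedekind sum. If M has trace > 2 and M' is an SL₂(ℤ)-conjugate of M, then n_M = n_{M'}. -/

import Mathlib

/-- The sawtooth function ((y)) : y - ⌊y⌋ - 1/2 if y ∉ ℤ, and 0 if y ∈ ℤ. -/
noncomputable def sawtooth (y : ℚ) : ℚ := if y.den = 1 then 0 else y - ⌊y⌋ - 1/2

/-- The Dedekind sum s(h,k) = Σ_{m=1}^{k} ((hm/k))((m/k)). -/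
noncomputable def dedekindS (h : ℤ) (k : ℕ) : ℚ :=
  ∑ m ∈ Finset.Icc 1 k, sawtooth ((h * m : ℤ) / (k : ℚ)) * sawtooth ((m : ℚ) / (k : ℚ))

/-- For M = (x y; z w) with z ≠ 0, n_M = (x+w)/z - sign(z)(3 + 12 s(w,|z|)). -/
noncomputable def nMat (M : Matrix (Fin 2) (Fin 2) ℤ) : ℚ :=
  ((M 0 0 + M 1 1 : ℤ) : ℚ) / ((M 1 0 : ℤ) : ℚ)
    - (Int.sign (M 1 0) : ℚ) * (3 + 12 * dedekindS (M 1 1) (M 1 0).natAbs)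

lemma saw_add_int (y : ℚ) (n : ℤ) : sawtooth (y + n) = sawtooth y := by
  unfold sawtooth
  have : (y + n).den = y.den := by simp
  rw [this, Int.floor_add_intCast]
  push_cast
  split_ifs <;> ring

lemma saw_neg (y : ℚ) : sawtooth (-y) = - sawtooth y := by
  unfold sawtooth
  have : (-y).den = y.den := by simp
  rw [this]
  split_ifs with h
  · simp
  · have h1 : Int.fract y ≠ 0 := by
      intro h0
      apply h
      rw [Int.fract_eq_iff] at h0
      obtain ⟨_, _, z, hz⟩ := h0
      have : y = z := by linarith
      rw [this]; simp
    have h2 := Int.fract_neg h1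
    unfold Int.fract at h2
    linarith

lemma saw_per (k : ℕ) (hk : 0 < k) (a b : ℤ) (h : a ≡ b [ZMOD k]) :
    sawtooth ((a : ℚ) / k) = sawtooth ((b : ℚ) / k) := by
  obtain ⟨c, hc⟩ := h.dvd
  have hk' : (k : ℚ) ≠ 0 := by positivity
  have : (b : ℚ) / k = (a : ℚ) / k + c := by
    have : (b : ℚ) = a + k * c := by
      have : b = a + k * c := by linarith
      exact_mod_cast this
    rw [this]; field_simp
  rw [this, saw_add_int]

lemma saw_lt (k m : ℕ) (h0 : 0 < m) (h : m < k) :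
    sawtooth (((m : ℤ) : ℚ) / k) = (m : ℚ) / k - 1 / 2 := by
  have hk : (0 : ℚ) < k := by exact_mod_cast (by omega : 0 < k)
  have hm : (0 : ℚ) < m := by exact_mod_cast h0
  have hmk : (m : ℚ) < k := by exact_mod_cast h
  have hf : ⌊(m : ℚ) / k⌋ = 0 := by
    rw [Int.floor_eq_iff]
    constructor
    · push_cast; positivity
    · push_cast; rw [div_lt_iff₀ hk]; linarith
  unfold sawtooth
  push_cast
  rw [if_neg, hf]
  · simp
  · intro hd
    have h1 := Rat.den_eq_one_iff _ |>.mp hd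
    have h3 : (((m : ℚ) / k).num : ℚ) = (⌊(m : ℚ) / k⌋ : ℤ) := by
      have : ⌊(m : ℚ) / k⌋ = ((m : ℚ) / k).num := by
        conv_lhs => rw [← h1]
        simp
      rw [this]
    rw [h1, hf] at h3
    have : (0 : ℚ) < m / k := by positivity
    simp at h3
    omega

lemma ded_eq (h : ℤ) (k : ℕ) (hk : 0 < k) : dedekindS h k =
    ∑ m ∈ Finset.range k, sawtooth (((h * m : ℤ) : ℚ) / k) * sawtooth (((m : ℤ) : ℚ) / k) := by
  unfold dedekindS
  have hk' : (k : ℚ) ≠ 0 := by positivity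
  have h1 : sawtooth (1 : ℚ) = 0 := by simp [sawtooth]
  have h0 : sawtooth (0 : ℚ) = 0 := by simp [sawtooth]
  obtain ⟨n, rfl⟩ : ∃ n, k = n + 1 := ⟨k - 1, by omega⟩
  rw [Finset.sum_range_succ', Finset.range_eq_Ico, Finset.sum_Ico_add'
    (fun m : ℕ => sawtooth (((h * m : ℤ) : ℚ) / ((n + 1 : ℕ) : ℚ)) * sawtooth (((m : ℤ) : ℚ) / ((n + 1 : ℕ) : ℚ)))]
  rw [show Finset.Icc 1 (n + 1) = Finset.Ico (0 + 1) (n + 1 + 1) by ext; simp]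
  rw [Finset.sum_Ico_succ_top (by omega)]
  rw [div_self hk', h1]
  simp [h0]

lemma perm_sum (h : ℤ) (k : ℕ) (hk : 0 < k) (hc : IsCoprime h k) (G : ℤ → ℚ)
    (hG : ∀ a b : ℤ, a ≡ b [ZMOD k] → G a = G b) :
    ∑ m ∈ Finset.range k, G (h * m) = ∑ m ∈ Finset.range k, G m := by
  have hk0 : (k : ℤ) ≠ 0 := by omega
  have hnn : ∀ m : ℕ, ((((h * m) % (k : ℤ)).toNat : ℕ) : ℤ) = (h * m) % (k : ℤ) := fun m =>
    Int.toNat_of_nonneg (Int.emod_nonneg _ hk0)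
  have hmaps : Set.MapsTo (fun m : ℕ => ((h * m) % (k : ℤ)).toNat) (Finset.range k) (Finset.range k) := by
    intro m hm
    have := Int.emod_lt_of_pos (h * m) (by omega : (0 : ℤ) < k)
    have := hnn m
    simp only [Finset.coe_range, Set.mem_Iio]
    omega
  have hinj : Set.InjOn (fun m : ℕ => ((h * m) % (k : ℤ)).toNat) (Finset.range k) := by
    intro a ha b hb hab
    simp only [Finset.coe_range, Set.mem_Iio] at ha hb
    have hab' : (h * a) % (k : ℤ) = (h * b) % (k : ℤ) := by
      rw [← hnn a, ← hnn b]; exact_mod_cast hab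
    have h1 : (k : ℤ) ∣ h * b - h * a := Int.ModEq.dvd hab'
    rw [← mul_sub] at h1
    have h2 := hc.symm.dvd_of_dvd_mul_left h1
    have h3 := Int.eq_zero_of_abs_lt_dvd h2 (by rw [abs_lt]; omega)
    omega
  refine Finset.sum_nbij (fun m : ℕ => ((h * m) % (k : ℤ)).toNat) hmaps hinj
    (Finset.surjOn_of_injOn_of_card_le _ hmaps hinj le_rfl) ?_
  intro m _
  rw [hnn]
  exact hG _ _ (Int.mod_modEq _ _).symm

lemma ded_per (k : ℕ) (hk : 0 < k) (a b : ℤ) (h : a ≡ b [ZMOD k]) :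
    dedekindS a k = dedekindS b k := by
  rw [ded_eq a k hk, ded_eq b k hk]
  refine Finset.sum_congr rfl fun m _ => ?_
  rw [saw_per k hk _ _ (h.mul_right m)]

lemma ded_neg (k : ℕ) (hk : 0 < k) (a : ℤ) : dedekindS (-a) k = - dedekindS a k := by
  rw [ded_eq _ k hk, ded_eq a k hk, ← Finset.sum_neg_distrib]
  refine Finset.sum_congr rfl fun m _ => ?_
  rw [← neg_mul, ← saw_neg]
  congr 2
  push_cast; ring

lemma ded_inv (k : ℕ) (hk : 0 < k) (a b : ℤ) (h : a * b ≡ 1 [ZMOD k]) :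
    dedekindS a k = dedekindS b k := by
  have hc : IsCoprime a k := by
    obtain ⟨c, hc⟩ := h.dvd
    exact ⟨b, c, by linarith⟩
  rw [ded_eq _ k hk, ded_eq b k hk, ← perm_sum a k hk hc
    (fun n => sawtooth (((b * n : ℤ) : ℚ) / k) * sawtooth ((n : ℚ) / k))]
  · refine Finset.sum_congr rfl fun m _ => ?_
    rw [mul_comm]
    congr 1
    apply saw_per k hk
    have := (h.mul_right m).symm
    rwa [one_mul, show a * b * m = b * (a * m) by ring] at this
  · intro x y hxy
    rw [saw_per k hk _ _ hxy, saw_per k hk _ _ (hxy.mul_left b)]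

lemma sum_m (k : ℕ) : ∑ m ∈ Finset.range k, (m : ℚ) = k * (k - 1) / 2 := by
  induction k with
  | zero => simp
  | succ n ih => rw [Finset.sum_range_succ, ih]; push_cast; ring

lemma sum_m2 (k : ℕ) : ∑ m ∈ Finset.range k, (m : ℚ) ^ 2 = k * (k - 1) * (2 * k - 1) / 6 := by
  induction k with
  | zero => simp
  | succ n ih => rw [Finset.sum_range_succ, ih]; push_cast; ring

lemma emod_cast (h k m : ℕ) : ((h * m : ℤ) % (k : ℤ) : ℤ) = (h * m : ℤ) - k * ((h * m / k : ℕ) : ℤ) := by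
  rw [Int.emod_def]; push_cast; ring

lemma sum_f (h k : ℕ) (hk : 0 < k) (hc : IsCoprime (h : ℤ) k) :
    ∑ m ∈ Finset.range k, ((h * m / k : ℕ) : ℚ) = (h - 1) * (k - 1) / 2 := by
  have hk' : (k : ℚ) ≠ 0 := by positivity
  have := perm_sum h k hk hc (fun n => ((n % (k : ℤ) : ℤ) : ℚ)) (by
    intro a b hab; rw [hab.eq])
  simp only [emod_cast] at this
  have h2 : ∑ m ∈ Finset.range k, (((m : ℤ) % (k : ℤ) : ℤ) : ℚ) = ∑ m ∈ Finset.range k, (m : ℚ) := by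
    refine Finset.sum_congr rfl fun m hm => ?_
    rw [Int.emod_eq_of_lt (by omega) (by simpa using hm)]; simp
  rw [h2] at this
  simp only [Int.cast_sub, Int.cast_mul, Int.cast_natCast, Finset.sum_sub_distrib, ← Finset.mul_sum] at this
  rw [sum_m] at this
  field_simp at this ⊢
  linear_combination -this

lemma sum_mf (h k : ℕ) (hk : 0 < k) (hc : IsCoprime (h : ℤ) k) :
    2 * h * k * ∑ m ∈ Finset.range k, (m : ℚ) * ((h * m / k : ℕ) : ℚ) =
     (h ^ 2 - 1) * (k * (k - 1) * (2 * k - 1) / 6)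
      + k ^ 2 * ∑ m ∈ Finset.range k, ((h * m / k : ℕ) : ℚ) ^ 2 := by
  have := perm_sum h k hk hc (fun n => ((n % (k : ℤ) : ℤ) : ℚ) ^ 2) (by
    intro a b hab; rw [hab.eq])
  simp only [emod_cast] at this
  have h2 : ∑ m ∈ Finset.range k, (((m : ℤ) % (k : ℤ) : ℤ) : ℚ) ^ 2 = ∑ m ∈ Finset.range k, (m : ℚ) ^ 2 := by
    refine Finset.sum_congr rfl fun m hm => ?_
    rw [Int.emod_eq_of_lt (by omega) (by simpa using hm)]; simp
  rw [h2] at this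
  have h3 : ∀ m ∈ Finset.range k, (((h * m : ℤ) - k * ((h * m / k : ℕ) : ℤ) : ℤ) : ℚ) ^ 2 =
      h ^ 2 * (m : ℚ) ^ 2 - (2 * h * k) * ((m : ℚ) * ((h * m / k : ℕ) : ℚ))
        + k ^ 2 * ((h * m / k : ℕ) : ℚ) ^ 2 := by
    intro m _; simp only [Int.cast_sub, Int.cast_mul, Int.cast_natCast]; ring
  rw [Finset.sum_congr rfl h3] at this
  simp only [Finset.sum_add_distrib, Finset.sum_sub_distrib, ← Finset.mul_sum] at this
  rw [sum_m2] at this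
  linear_combination -this

lemma count_f (h k : ℕ) (hh : 0 < h) (hk : 0 < k) (hc : Nat.Coprime h k) :
    ∑ m ∈ Finset.range k, ((h * m / k : ℕ) : ℚ) ^ 2 + ∑ m ∈ Finset.range k, ((h * m / k : ℕ) : ℚ)
      + 2 * ∑ j ∈ Finset.range h, (j : ℚ) * ((k * j / h : ℕ) : ℚ) = (k - 1) * (h * (h - 1)) := by
  have e1 : ∀ m ∈ Finset.range k, ∑ j ∈ Finset.range h, (if k * j ≤ h * m then 2 * (j : ℚ) else 0)
      = ((h * m / k : ℕ) : ℚ) ^ 2 + ((h * m / k : ℕ) : ℚ) := by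
    intro m hm
    have hm' : m < k := by simpa using hm
    rw [← Finset.sum_filter]
    have : (Finset.range h).filter (fun j => k * j ≤ h * m) = Finset.range (h * m / k + 1) := by
      ext j
      simp only [Finset.mem_filter, Finset.mem_range, Nat.lt_succ_iff]
      rw [Nat.le_div_iff_mul_le hk, mul_comm j k]
      constructor
      · exact fun h => h.2
      · intro hj
        refine ⟨?_, hj⟩
        by_contra hcon
        have : k * h ≤ k * j := Nat.mul_le_mul_left _ (by omega)
        have : h * m < h * k := Nat.mul_lt_mul_of_pos_left hm' hh
        nlinarith
    rw [this, ← Finset.mul_sum, sum_m]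
    push_cast; ring
  have e2 : ∀ j ∈ Finset.range h, ∑ m ∈ Finset.range k, (if k * j ≤ h * m then 2 * (j : ℚ) else 0)
      = 2 * (k - 1) * j - 2 * ((j : ℚ) * ((k * j / h : ℕ) : ℚ)) := by
    intro j hj
    have hj' : j < h := by simpa using hj
    rcases Nat.eq_zero_or_pos j with rfl | hj0
    · simp
    rw [← Finset.sum_filter]
    have : (Finset.range k).filter (fun m => k * j ≤ h * m) = Finset.Ico (k * j / h + 1) k := by
      ext m
      simp only [Finset.mem_filter, Finset.mem_range, Finset.mem_Ico, Nat.succ_le_iff]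
      rw [Nat.div_lt_iff_lt_mul hh, mul_comm m h]
      have : k * j ≠ h * m := by
        intro he
        have : h ∣ j := hc.dvd_of_dvd_mul_left ⟨m, he⟩
        have := Nat.le_of_dvd hj0 this
        omega
      omega
    have hlt : k * j / h < k := by
      rw [Nat.div_lt_iff_lt_mul hh]
      exact Nat.mul_lt_mul_of_pos_left hj' hk
    rw [this, Finset.sum_const, Nat.card_Ico, nsmul_eq_mul, Nat.cast_sub (by omega)]
    push_cast; ring
  have e := Finset.sum_comm (s := Finset.range k) (t := Finset.range h)
    (f := fun m j => if k * j ≤ h * m then 2 * (j : ℚ) else 0)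
  rw [Finset.sum_congr rfl e1, Finset.sum_congr rfl e2] at e
  simp only [Finset.sum_add_distrib, Finset.sum_sub_distrib, ← Finset.mul_sum] at e
  rw [sum_m] at e
  linear_combination e

lemma ded_formula (h k : ℕ) (hk : 0 < k) (hc : IsCoprime (h : ℤ) k) :
    dedekindS h k = h * ((k - 1) * (2 * k - 1) / 6) / k
      - (∑ m ∈ Finset.range k, (m : ℚ) * ((h * m / k : ℕ) : ℚ)) / k - (k - 1) / 4 := by
  have hk' : (k : ℚ) ≠ 0 := by positivity
  have hz : sawtooth 0 = 0 := by simp [sawtooth]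
  have e : ∀ m ∈ Finset.range k, sawtooth (((h * m : ℤ) : ℚ) / k) * sawtooth (((m : ℤ) : ℚ) / k)
     = (h / k ^ 2) * (m : ℚ) ^ 2 - (1 / k) * ((m : ℚ) * ((h * m / k : ℕ) : ℚ)) - (1 / (2 * k)) * m
        - (1 / 2) * sawtooth (((h * m : ℤ) : ℚ) / k) := by
    intro m hm
    have hm' : m < k := by simpa using hm
    rcases Nat.eq_zero_or_pos m with rfl | hm0
    · simp [hz]
    rw [saw_lt k m hm0 hm']
    have hne : h * m % k ≠ 0 := by
      intro h0
      have : k ∣ m := (Nat.isCoprime_iff_coprime.mp hc).symm.dvd_of_dvd_mul_left (Nat.dvd_of_mod_eq_zero h0)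
      have := Nat.le_of_dvd hm0 this
      omega
    have hs : sawtooth (((h * m : ℤ) : ℚ) / k) = (h * m) / k - ((h * m / k : ℕ) : ℚ) - 1 / 2 := by
      rw [saw_per k hk (h * m : ℤ) ((h * m % k : ℕ) : ℤ) (by push_cast; exact (Int.mod_modEq _ _).symm),
        saw_lt k _ (by omega) (Nat.mod_lt _ hk)]
      have : ((h * m : ℕ) : ℚ) = k * ((h * m / k : ℕ) : ℚ) + ((h * m % k : ℕ) : ℚ) := by
        exact_mod_cast (Nat.div_add_mod (h * m) k).symm
      rw [← Nat.cast_mul, this]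
      field_simp
      ring
    rw [hs]
    field_simp
  rw [ded_eq _ k hk, Finset.sum_congr rfl e]
  have hs0 : ∑ m ∈ Finset.range k, sawtooth (((h * m : ℤ) : ℚ) / k) = 0 := by
    have h1 := perm_sum h k hk hc (fun n => sawtooth ((n : ℚ) / k)) (fun a b hab => saw_per k hk a b hab)
    have h2 := perm_sum (-1) k hk ⟨-1, 0, by ring⟩ (fun n => sawtooth ((n : ℚ) / k)) (fun a b hab => saw_per k hk a b hab)
    have h3 : ∑ m ∈ Finset.range k, sawtooth (((-1 * m : ℤ) : ℚ) / k)
        = - ∑ m ∈ Finset.range k, sawtooth (((m : ℤ) : ℚ) / k) := by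
      rw [← Finset.sum_neg_distrib]
      refine Finset.sum_congr rfl fun m _ => ?_
      rw [← saw_neg]; congr 1; push_cast; ring
    rw [h1]
    linarith
  simp only [Finset.sum_sub_distrib, ← Finset.mul_sum]
  rw [hs0, sum_m, sum_m2]
  field_simp
  ring

lemma recip (h k : ℕ) (hh : 0 < h) (hk : 0 < k) (hc : IsCoprime (h : ℤ) k) :
    12 * dedekindS h k + 12 * dedekindS k h = -3 + (h / k + k / h + 1 / (h * k) : ℚ) := by
  have hk' : (k : ℚ) ≠ 0 := by positivity
  have hh' : (h : ℚ) ≠ 0 := by positivity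
  rw [ded_formula h k hk hc, ded_formula k h hh hc.symm]
  have h1 := sum_f h k hk hc
  have h2 := sum_mf h k hk hc
  have h3 := count_f h k hh hk (Nat.isCoprime_iff_coprime.mp hc)
  rw [h1] at h3
  generalize ∑ m ∈ Finset.range k, (m : ℚ) * ((h * m / k : ℕ) : ℚ) = X at *
  generalize ∑ m ∈ Finset.range k, ((h * m / k : ℕ) : ℚ) ^ 2 = Y at *
  generalize ∑ j ∈ Finset.range h, (j : ℚ) * ((k * j / h : ℕ) : ℚ) = Z at *
  have hX : X = ((h ^ 2 - 1) * (k * (k - 1) * (2 * k - 1) / 6) + k ^ 2 * Y) / (2 * h * k) := by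
    rw [← h2]; field_simp
  have hY : Y = (k - 1) * (h * (h - 1)) - (h - 1) * (k - 1) / 2 - 2 * Z := by linarith
  rw [hX, hY]
  field_simp
  ring

/-- reciprocity with sign -/
lemma recip_sign (w z : ℤ) (hw : 0 < w) (hz : z ≠ 0) (hc : IsCoprime w z) :
    (Int.sign z : ℚ) * (3 + 12 * dedekindS w z.natAbs) + 12 * dedekindS z w.natAbs
      = (w / z + z / w + 1 / (w * z) : ℚ) := by
  obtain ⟨h, rfl⟩ := Int.eq_ofNat_of_zero_le hw.le
  have hh : 0 < h := by omega
  rcases lt_or_gt_of_ne hz with hneg | hpos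
  · obtain ⟨k, hk⟩ := Int.eq_ofNat_of_zero_le (by omega : 0 ≤ -z)
    obtain rfl : z = -k := by omega
    have hk0 : 0 < k := by omega
    have := recip h k hh hk0 (IsCoprime.neg_right_iff _ _ |>.mp hc)
    rw [Int.sign_eq_neg_one_of_neg hneg]
    simp only [Int.natAbs_neg, Int.natAbs_natCast]
    rw [ded_neg _ hh]
    push_cast
    rw [mul_neg, mul_neg, div_neg, div_neg, neg_div]
    linarith
  · obtain ⟨k, rfl⟩ := Int.eq_ofNat_of_zero_le hpos.le
    have hk0 : 0 < k := by omega
    have := recip h k hh hk0 hc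
    rw [Int.sign_eq_one_of_pos hpos]
    simp only [Int.natAbs_natCast]
    push_cast
    linarith

lemma key (x y z w : ℤ) (hd : x * w - y * z = 1) (hw : 0 < w) (hz : z ≠ 0) (hy : y ≠ 0) :
    (Int.sign z : ℚ) * (3 + 12 * dedekindS w z.natAbs)
      + (Int.sign y : ℚ) * (3 + 12 * dedekindS w y.natAbs) = (x + w) / z + (x + w) / y := by
  have h1 := recip_sign w z hw hz ⟨x, -y, by linarith⟩
  have h2 := recip_sign w y hw hy ⟨x, -z, by linarith⟩
  have h3 : dedekindS y w.natAbs = - dedekindS z w.natAbs := by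
    rw [← ded_neg _ (by omega)]
    apply ded_inv _ (by omega)
    rw [Int.natCast_natAbs, abs_of_pos hw]
    apply Int.ModEq.symm
    rw [Int.modEq_iff_dvd]
    exact ⟨-x, by linarith⟩
  have hd' : (x * w - y * z : ℚ) = 1 := by exact_mod_cast hd
  have hw' : (w : ℚ) ≠ 0 := by exact_mod_cast hw.ne'
  have hz' : (z : ℚ) ≠ 0 := by exact_mod_cast hz
  have hy' : (y : ℚ) ≠ 0 := by exact_mod_cast hy
  have h4 : (w / z + z / w + 1 / (w * z) : ℚ) + (w / y + y / w + 1 / (w * y) : ℚ)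
      = (x + w) / z + (x + w) / y := by
    field_simp
    linear_combination -(z + y) * hd'
  rw [h3] at h2
  linarith

lemma ded_symm_z (x y z w : ℤ) (hd : x * w - y * z = 1) (hz : z ≠ 0) :
    dedekindS x z.natAbs = dedekindS w z.natAbs := by
  apply ded_inv _ (by omega)
  rw [Int.natCast_natAbs]
  apply Int.ModEq.symm
  rw [Int.modEq_iff_dvd, abs_dvd]
  exact ⟨y, by linarith⟩

lemma key2 (x y z w : ℤ) (hd : x * w - y * z = 1) (ht : 0 < x + w) (hz : z ≠ 0) (hy : y ≠ 0) :
    (Int.sign z : ℚ) * (3 + 12 * dedekindS w z.natAbs)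
      + (Int.sign y : ℚ) * (3 + 12 * dedekindS x y.natAbs) = (x + w) / z + (x + w) / y := by
  rcases lt_or_ge 0 w with hw | hw
  · rw [ded_symm_z x z y w (by linarith) hy]
    exact key x y z w hd hw hz hy
  · rw [← ded_symm_z x y z w hd hz]
    have := key w y z x (by linarith) (by omega) hz hy
    rw [this]; ring

lemma off_ne (x y z w : ℤ) (hd : x * w - y * z = 1) (ht : 2 < x + w) : z ≠ 0 ∧ y ≠ 0 := by
  have : y * z ≠ 0 := by
    intro h0
    have h1 : x * w = 1 := by linarith
    rcases Int.mul_eq_one_iff_eq_one_or_neg_one.mp h1 with h | h <;> omega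
  exact ⟨right_ne_zero_of_mul this, left_ne_zero_of_mul this⟩

lemma main_gen (A : Matrix.SpecialLinearGroup (Fin 2) ℤ) :
    ∀ M : Matrix.SpecialLinearGroup (Fin 2) ℤ,
    2 < Matrix.trace (M : Matrix (Fin 2) (Fin 2) ℤ) →
    nMat (M : Matrix (Fin 2) (Fin 2) ℤ)
      = nMat ((A * M * A⁻¹ : Matrix.SpecialLinearGroup (Fin 2) ℤ) : Matrix (Fin 2) (Fin 2) ℤ) := by
  have htr : ∀ A M : Matrix.SpecialLinearGroup (Fin 2) ℤ,
      Matrix.trace ((A * M * A⁻¹ : Matrix.SpecialLinearGroup (Fin 2) ℤ) : Matrix (Fin 2) (Fin 2) ℤ)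
        = Matrix.trace (M : Matrix (Fin 2) (Fin 2) ℤ) := by
    intro A M
    rw [Matrix.SpecialLinearGroup.coe_mul, Matrix.trace_mul_comm, ← Matrix.SpecialLinearGroup.coe_mul,
      ← mul_assoc, inv_mul_cancel, one_mul]
  have hA : A ∈ Subgroup.closure {ModularGroup.S, ModularGroup.T} := by
    rw [SpecialLinearGroup.SL2Z_generators]; trivial
  induction hA using Subgroup.closure_induction with
  | one => intro M _; simp
  | mul A B _ _ hA hB =>
    intro M hM
    have e : A * B * M * (A * B)⁻¹ = A * (B * M * B⁻¹) * A⁻¹ := by group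
    rw [e, hB M hM, hA _ (by rw [htr]; exact hM)]
  | inv A _ hA =>
    intro M hM
    have e : A * (A⁻¹ * M * A⁻¹⁻¹) * A⁻¹ = M := by group
    rw [hA (A⁻¹ * M * A⁻¹⁻¹) (by rw [htr]; exact hM), e]
  | mem A hA =>
    intro M hM
    have hd := M.det_coe
    rw [Matrix.det_fin_two] at hd
    rw [Matrix.trace_fin_two] at hM
    obtain ⟨hz, hy⟩ := off_ne _ _ _ _ hd hM
    rcases hA with rfl | rfl
    · have k2 := key2 _ _ _ _ hd (by omega) hz hy
      have e : ((ModularGroup.S * M * ModularGroup.S⁻¹ : Matrix.SpecialLinearGroup (Fin 2) ℤ) : Matrix (Fin 2) (Fin 2) ℤ)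
          = !![M.1 1 1, - M.1 1 0; - M.1 0 1, M.1 0 0] := by
        rw [Matrix.SpecialLinearGroup.coe_mul, Matrix.SpecialLinearGroup.coe_mul,
          Matrix.SpecialLinearGroup.coe_inv, ModularGroup.coe_S, Matrix.adjugate_fin_two]
        ext i j
        fin_cases i <;> fin_cases j <;> simp [Matrix.mul_apply, Matrix.vecMul, dotProduct, Fin.sum_univ_two]
      rw [e]
      simp only [nMat, Matrix.of_apply, Matrix.cons_val', Matrix.cons_val_zero, Matrix.cons_val_one,
        Matrix.cons_val_fin_one, Int.sign_neg, Int.natAbs_neg]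
      push_cast
      rw [div_neg, add_comm ((M.1 1 1 : ℤ) : ℚ)]
      linarith
    · have e : ((ModularGroup.T * M * ModularGroup.T⁻¹ : Matrix.SpecialLinearGroup (Fin 2) ℤ) : Matrix (Fin 2) (Fin 2) ℤ)
          = !![M.1 0 0 + M.1 1 0, M.1 0 1 + M.1 1 1 - M.1 0 0 - M.1 1 0; M.1 1 0, M.1 1 1 - M.1 1 0] := by
        rw [Matrix.SpecialLinearGroup.coe_mul, Matrix.SpecialLinearGroup.coe_mul,
          Matrix.SpecialLinearGroup.coe_inv, ModularGroup.coe_T, Matrix.adjugate_fin_two]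
        ext i j
        fin_cases i <;> fin_cases j <;> simp [Matrix.mul_apply, Matrix.vecMul, dotProduct, Fin.sum_univ_two] <;> try ring
      rw [e]
      simp only [nMat, Matrix.of_apply, Matrix.cons_val', Matrix.cons_val_zero, Matrix.cons_val_one,
        Matrix.cons_val_fin_one]
      rw [ded_per (M.1 1 0).natAbs (by omega) (M.1 1 1 - M.1 1 0) (M.1 1 1)]
      · push_cast; ring
      · rw [Int.natCast_natAbs, Int.modEq_iff_dvd, abs_dvd]
        exact ⟨1, by ring⟩

theorem stmt_11 (M A : Matrix.SpecialLinearGroup (Fin 2) ℤ)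
    (hz : (M : Matrix (Fin 2) (Fin 2) ℤ) 1 0 ≠ 0)
    (htr : 2 < (M : Matrix (Fin 2) (Fin 2) ℤ) 0 0 + (M : Matrix (Fin 2) (Fin 2) ℤ) 1 1) :
    nMat (M : Matrix (Fin 2) (Fin 2) ℤ)
      = nMat ((A * M * A⁻¹ : Matrix.SpecialLinearGroup (Fin 2) ℤ) : Matrix (Fin 2) (Fin 2) ℤ) := by
  apply main_gen
  rw [Matrix.trace_fin_two]
  exact htr
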